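/- arXiv:0808.2543 — 6 statements merged into one kernel-verified Lean document; each statement's English description precedes it below -/
import Mathlib

section
/- Let (E,σ) be a difference field of characteristic zero, let F be a subfield of E with σ(F) = F, and let t ∈ E satisfy σ(t) = a·t + f where a, f ∈ F and a ≠ 0. Then the following are equivalent: (i) F(t) is a Σ*-extension of F, i.e. t is transcendental over F, σ(t) − t is a nonzero element of F, and const(F(t),σ) = const(F,σ); (ii) a = 1 and there exists no g ∈ F with σ(g) − g = f. -/
/-- `F(t)`: the subfield of `E` generated by the subfield `F` and the element `t`. -/
def adj {E : Type*} [Field E] (F : Subfield E) (t : E) : Subfield E :=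
  Subfield.closure ((F : Set E) ∪ {t})

/-- The set of constants of the subfield `F` with respect to the automorphism `σ`. -/
def constSet {E : Type*} [Field E] (σ : E ≃+* E) (F : Subfield E) : Set E :=
  {c : E | c ∈ F ∧ σ c = c}

section

open Polynomial

/-- A nonconstant polynomial fixed by `p ↦ p^s(X + f)` yields a solution of `s g - g = f`. -/
theorem exists_sub_eq_of_taylor_map_eq {K : Type*} [Field K] [CharZero K] (s : K →+* K) (f : K)
    (p : K[X]) (hp : 0 < p.natDegree) (h : taylor f (p.map s) = p) : ∃ g, s g - g = f := by
  obtain ⟨m, hm⟩ : ∃ m, p.natDegree = m + 1 := ⟨p.natDegree - 1, by omega⟩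
  have hl0 : p.coeff (m + 1) ≠ 0 := by
    rw [← hm]
    exact leadingCoeff_ne_zero.2 (ne_zero_of_natDegree_gt hp)
  have hd : (p.map s).natDegree = m + 1 := by rw [natDegree_map, hm]
  have hlead : s (p.coeff (m + 1)) = p.coeff (m + 1) := by
    have := congrArg leadingCoeff h
    rw [leadingCoeff_taylor, leadingCoeff_map] at this
    rwa [leadingCoeff, hm] at this
  have hsub : s (p.coeff m) + (m + 1) * p.coeff (m + 1) * f = p.coeff m := by
    have hc := congrArg (fun r => coeff r m) h
    simp only [taylor_coeff] at hc
    have hdeg : (hasseDeriv m (p.map s)).natDegree < 2 := by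
      have := natDegree_hasseDeriv_le (p.map s) m
      omega
    rw [eval_eq_sum_range' hdeg, Finset.sum_range_succ, Finset.sum_range_one,
      hasseDeriv_coeff, hasseDeriv_coeff] at hc
    simp only [coeff_map, zero_add, add_comm 1 m, Nat.choose_self, Nat.choose_succ_self_right,
      hlead] at hc
    push_cast at hc
    linear_combination hc
  have hm0 : (m + 1 : K) ≠ 0 := by exact_mod_cast Nat.succ_ne_zero m
  refine ⟨-p.coeff m / ((m + 1) * p.coeff (m + 1)), ?_⟩
  simp only [map_div₀, map_neg, map_mul, map_add, map_natCast, map_one, hlead]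
  field_simp
  linear_combination -hsub

/-- The action of `σ` on `K[t]` with `σ t = t + f` is given by `p ↦ p^s(X + f)`. -/
theorem aeval_taylor_map {K E : Type*} [Field K] [Field E] [Algebra K E] {s : K →+* K}
    {σ : E →+* E} (hs : ∀ x, algebraMap K E (s x) = σ (algebraMap K E x)) {t : E} {f : K}
    (ht : σ t = t + algebraMap K E f) (p : K[X]) :
    aeval t (taylor f (p.map s)) = σ (aeval t p) := by
  have hcomp : (algebraMap K E).comp s = σ.comp (algebraMap K E) := RingHom.ext hs
  rw [taylor_apply, aeval_comp, aeval_def, eval₂_map, aeval_def (p := p), hom_eval₂, hcomp, ht]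
  simp

theorem Polynomial.Monic.taylor_map_eq_of_dvd {K : Type*} [Field K] {s : K →+* K} {f : K}
    {p : K[X]} (hp : p.Monic) (h : p ∣ taylor f (p.map s)) : taylor f (p.map s) = p := by
  refine eq_of_monic_of_dvd_of_natDegree_le hp ?_ h ?_
  · rw [Monic, leadingCoeff_taylor]
    exact hp.map s
  · rw [natDegree_taylor, Polynomial.natDegree_map]

/-- Every element of `K(t)` is a reduced fraction in `t` with monic denominator. -/
theorem exists_isCoprime_monic_aeval_div_aeval_eq {K E : Type*} [Field K] [Field E] [Algebra K E]
    {t u : E} (hu : u ∈ IntermediateField.adjoin K {t}) :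
    ∃ p q : K[X], q.Monic ∧ IsCoprime p q ∧ u = aeval t p / aeval t q := by
  obtain ⟨p, q, rfl⟩ := (IntermediateField.mem_adjoin_simple_iff K u).1 hu
  by_cases hq : aeval t q = 0
  · exact ⟨0, 1, monic_one, isCoprime_one_right, by simp [hq]⟩
  have hq0 : q ≠ 0 := by
    rintro rfl
    exact hq (map_zero _)
  have hdenom : aeval t (algebraMap K[X] (RatFunc K) p / algebraMap K[X] (RatFunc K) q).denom ≠ 0 :=
    fun h => hq (aeval_eq_zero_of_dvd_aeval_eq_zero (RatFunc.denom_div_dvd p q) h)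
  refine ⟨_, _, RatFunc.monic_denom _, RatFunc.isCoprime_num_denom _,
    (div_eq_div_iff hq hdenom).2 ?_⟩
  rw [← map_mul, ← map_mul, (RatFunc.num_mul_eq_mul_denom_iff hq0).2 rfl]

/-- If `s g - g = f` has no solution in `K` and `σ t = t + f`, then `t` is transcendental over `K`. -/
theorem transcendental_of_forall_sub_ne {K E : Type*} [Field K] [CharZero K] [Field E]
    [Algebra K E] {s : K →+* K} {σ : E →+* E}
    (hs : ∀ x, algebraMap K E (s x) = σ (algebraMap K E x)) {t : E} {f : K}
    (ht : σ t = t + algebraMap K E f) (hf : ∀ g, s g - g ≠ f) : Transcendental K t := by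
  intro halg
  have hint := halg.isIntegral
  have key : taylor f ((minpoly K t).map s) = minpoly K t :=
    (minpoly.monic hint).taylor_map_eq_of_dvd <| minpoly.dvd K t <| by
      rw [aeval_taylor_map hs ht, minpoly.aeval, map_zero]
  obtain ⟨g, hg⟩ := exists_sub_eq_of_taylor_map_eq s f _ (minpoly.natDegree_pos hint) key
  exact hf g hg

/-- If `s g - g = f` has no solution in `K` and `σ t = t + f`, then every constant of `K(t)`
lies in `K`. -/
theorem mem_range_algebraMap_of_fixed {K E : Type*} [Field K] [CharZero K] [Field E]
    [Algebra K E] {s : K →+* K} {σ : E →+* E}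
    (hs : ∀ x, algebraMap K E (s x) = σ (algebraMap K E x)) {t : E} {f : K}
    (ht : σ t = t + algebraMap K E f) (hf : ∀ g, s g - g ≠ f) {u : E}
    (hu : u ∈ IntermediateField.adjoin K {t}) (hσu : σ u = u) :
    u ∈ Set.range (algebraMap K E) := by
  have htr := transcendental_of_forall_sub_ne hs ht hf
  have hinj : Function.Injective (aeval t : K[X] →ₐ[K] E) :=
    transcendental_iff_injective.1 htr
  obtain ⟨p, q, hq, hpq, rfl⟩ := exists_isCoprime_monic_aeval_div_aeval_eq hu
  have hconst (r : K[X]) (hr : taylor f (r.map s) = r) : r = C (r.coeff 0) := by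
    refine eq_C_of_natDegree_eq_zero (Nat.eq_zero_of_not_pos fun h => ?_)
    obtain ⟨g, hg⟩ := exists_sub_eq_of_taylor_map_eq s f r h hr
    exact hf g hg
  have hq0 : aeval t q ≠ 0 := (map_ne_zero_iff _ hinj).2 hq.ne_zero
  have hcross : taylor f (p.map s) * q = p * taylor f (q.map s) := by
    apply hinj
    rw [map_div₀, div_eq_div_iff ((map_ne_zero σ).2 hq0) hq0] at hσu
    simpa only [map_mul, aeval_taylor_map hs ht] using hσu
  have hqq : taylor f (q.map s) = q :=
    hq.taylor_map_eq_of_dvd <|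
      hpq.symm.dvd_of_dvd_mul_left ⟨_, by rw [← hcross, mul_comm]⟩
  have hpp : taylor f (p.map s) = p := by
    rw [hqq] at hcross
    exact mul_right_cancel₀ hq.ne_zero hcross
  rw [hconst p hpp, hconst q hqq]
  exact ⟨p.coeff 0 / q.coeff 0, by simp⟩

end

/-- Characterization of Σ*-extensions: for `σ(t) = a·t + f` with `a, f ∈ F`, `a ≠ 0`,
`F(t)` is a Σ*-extension of `F` iff `a = 1` and the telescoping equation
`σ(g) - g = f` has no solution `g ∈ F`. -/
theorem sigmaStar_criterion {E : Type*} [Field E] [CharZero E] (σ : E ≃+* E)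
    (F : Subfield E) (hF : F.map (σ : E →+* E) = F)
    (t a f : E) (ha : a ∈ F) (hf : f ∈ F) (ha0 : a ≠ 0)
    (hσt : σ t = a * t + f) :
    (Transcendental F t ∧ σ t - t ∈ F ∧ σ t - t ≠ 0 ∧
        constSet σ (adj F t) = constSet σ F) ↔
      (a = 1 ∧ ¬ ∃ g ∈ F, σ g - g = f) := by
  have hadj : adj F t = (IntermediateField.adjoin F {t}).toSubfield := by
    have hrange : Set.range (algebraMap F E) = F := Subtype.range_coe
    ext x
    rw [adj, ← hrange]
    rfl
  have htadj : t ∈ adj F t := Subfield.subset_closure (Or.inr rfl)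
  have hFadj : F ≤ adj F t := fun x hx => Subfield.subset_closure (Or.inl hx)
  constructor
  · rintro ⟨htr, hmem, -, hconst⟩
    have htF : t ∉ F := fun h => htr (isAlgebraic_algebraMap (⟨t, h⟩ : F))
    have ha1 : a = 1 := by
      by_contra hne
      refine htF ?_
      have : t = (σ t - t - f) / (a - 1) := by
        rw [eq_div_iff (sub_ne_zero.2 hne), hσt]
        ring
      rw [this]
      exact div_mem (sub_mem hmem hf) (sub_mem ha (one_mem F))
    refine ⟨ha1, ?_⟩
    rintro ⟨g, hg, hgf⟩
    have hc : t - g ∈ constSet σ (adj F t) := by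
      refine ⟨sub_mem htadj (hFadj hg), ?_⟩
      rw [map_sub, hσt, ha1, ← hgf]
      ring
    rw [hconst] at hc
    exact htF (by simpa using add_mem hc.1 hg)
  · rintro ⟨rfl, hno⟩
    have hσF : ∀ x ∈ F, σ x ∈ F := fun x hx => by
      have : (σ : E →+* E) x ∈ F.map (σ : E →+* E) := ⟨x, hx, rfl⟩
      rwa [hF] at this
    let s : F →+* F := (σ : E →+* E).restrict F F hσF
    have hs : ∀ x, algebraMap F E (s x) = (σ : E →+* E) (algebraMap F E x) := fun x => rfl
    have ht : (σ : E →+* E) t = t + algebraMap F E ⟨f, hf⟩ := by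
      rw [one_mul] at hσt
      exact hσt
    have hne : ∀ g, s g - g ≠ ⟨f, hf⟩ := fun g hg => hno ⟨g, g.2, congrArg Subtype.val hg⟩
    have hdiff : σ t - t = f := by
      rw [hσt]
      ring
    refine ⟨transcendental_of_forall_sub_ne hs ht hne, hdiff ▸ hf, ?_, ?_⟩
    · rw [hdiff]
      rintro rfl
      exact hno ⟨0, zero_mem F, by simp⟩
    · refine Set.Subset.antisymm ?_ fun c hc => ⟨hFadj hc.1, hc.2⟩
      rintro c ⟨hc, hσc⟩
      rw [hadj] at hc
      obtain ⟨x, rfl⟩ := mem_range_algebraMap_of_fixed hs ht hne hc hσc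
      exact ⟨x.2, hσc⟩
end

section
/- Let (E,σ) be a difference field of characteristic zero, let F be a subfield of E with σ(F) = F, and let t ∈ E satisfy σ(t) = a·t + f where a, f ∈ F and a ≠ 0. Then the following are equivalent: (i) F(t) is a Π-extension of F, i.e. t is transcendental over F, f = 0 (so σ(t) = a·t), and const(F(t),σ) = const(F,σ); (ii) t ≠ 0, f = 0, and there exist no g ∈ F with g ≠ 0 and no integer m > 0 such that σ(g) = a^m·g. -/
open Polynomial in
/-- A nonzero ideal of `K[X]` stable under `q(X) ↦ q^s(aX)` contains a power of `X`, provided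
`s g = a ^ m * g` has no nonzero solution `g` with `m > 0`. -/
theorem exists_X_pow_mem_of_twist_stable {K : Type*} [Field K] (s : K →+* K) {a : K}
    (h : ∀ g : K, g ≠ 0 → ∀ m : ℕ, 0 < m → s g ≠ a ^ m * g) (ha : a ≠ 0)
    (I : Ideal K[X]) (hI : I ≠ ⊥) (hs : ∀ q ∈ I, (q.map s).comp (C a * X) ∈ I) :
    ∃ n : ℕ, (X ^ n : K[X]) ∈ I := by
  obtain ⟨q, hq, hqI⟩ : ∃ q : K[X], q.Monic ∧ I = Ideal.span {q} := by
    obtain ⟨q, rfl⟩ := (IsPrincipalIdealRing.principal I).principal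
    have hq : q ≠ 0 := by
      rintro rfl
      simp at hI
    exact ⟨q * C q.leadingCoeff⁻¹, monic_mul_leadingCoeff_inv hq,
      (Ideal.span_singleton_mul_right_unit
        (isUnit_C.2 (inv_ne_zero (leadingCoeff_ne_zero.2 hq)).isUnit) q).symm⟩
  subst hqI
  have hdvd := Ideal.mem_span_singleton.1 (hs q (Ideal.mem_span_singleton_self q))
  have hcoeff (i : ℕ) : ((q.map s).comp (C a * X)).coeff i = s (q.coeff i) * a ^ i := by
    rw [comp_C_mul_X_coeff, coeff_map]
  have heq : (q.map s).comp (C a * X) - C (a ^ q.natDegree) * q = 0 := by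
    refine eq_zero_of_dvd_of_degree_lt (hdvd.sub (Dvd.intro_left _ rfl)) ?_
    rw [degree_eq_natDegree hq.ne_zero, degree_lt_iff_coeff_zero]
    intro i hi
    rw [coeff_sub, hcoeff, coeff_C_mul]
    rcases hi.eq_or_lt with rfl | hi
    · simp [hq.coeff_natDegree]
    · simp [coeff_eq_zero_of_natDegree_lt hi]
  refine ⟨q.natDegree, ?_⟩
  convert Ideal.mem_span_singleton_self q
  ext i
  rw [coeff_X_pow]
  split_ifs with hi
  · rw [hi, hq.coeff_natDegree]
  rcases lt_or_gt_of_ne hi with hi | hi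
  · by_contra hne
    refine h _ (Ne.symm hne) (q.natDegree - i) (Nat.sub_pos_of_lt hi) ?_
    have := congrArg (coeff · i) heq
    simp only [coeff_sub, hcoeff, coeff_C_mul, coeff_zero, sub_eq_zero] at this
    apply mul_right_cancel₀ (pow_ne_zero i ha)
    rw [this, mul_right_comm, ← pow_add, Nat.sub_add_cancel hi.le]
  · rw [coeff_eq_zero_of_natDegree_lt hi]

open Polynomial in
/-- A polynomial with `p^s(aX) = a ^ n * p` is a monomial of degree `n`, provided
`s g = a ^ m * g` has no nonzero solution `g` with `m > 0`. -/
theorem eq_C_mul_X_pow_of_twist_eq {K : Type*} [Field K] (s : K →+* K) {a : K}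
    (h : ∀ g : K, g ≠ 0 → ∀ m : ℕ, 0 < m → s g ≠ a ^ m * g) (ha : a ≠ 0) (n : ℕ) (p : K[X])
    (hp : (p.map s).comp (C a * X) = C (a ^ n) * p) :
    p = C (p.coeff n) * X ^ n := by
  ext i
  rw [coeff_C_mul_X_pow]
  split_ifs with hi
  · rw [hi]
  have key : s (p.coeff i) * a ^ i = a ^ n * p.coeff i := by
    simpa only [comp_C_mul_X_coeff, coeff_map, coeff_C_mul] using congrArg (coeff · i) hp
  by_contra hne
  rcases lt_or_gt_of_ne hi with hi | hi
  · refine h _ hne (n - i) (Nat.sub_pos_of_lt hi) ?_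
    apply mul_right_cancel₀ (pow_ne_zero i ha)
    rw [key, mul_right_comm, ← pow_add, Nat.sub_add_cancel hi.le]
  · refine h _ (inv_ne_zero hne) (i - n) (Nat.sub_pos_of_lt hi) ?_
    have hs : s (p.coeff i) ≠ 0 := by simpa using hne
    rw [← Nat.sub_add_cancel hi.le, pow_add, Nat.sub_add_cancel hi.le] at key
    rw [map_inv₀]
    field_simp
    apply mul_right_cancel₀ (pow_ne_zero n ha)
    linear_combination -key

open Polynomial in
/-- Elements of `F(t)` are quotients of polynomials in `t`. -/
theorem mem_adj_iff {E : Type*} [Field E] (F : Subfield E) (t c : E) :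
    c ∈ adj F t ↔ ∃ p q : F[X], c = aeval t p / aeval t q := by
  rw [← IntermediateField.mem_adjoin_simple_iff F c, ← IntermediateField.mem_toSubfield]
  have hF : Set.range (algebraMap F E) = F := Subtype.range_coe
  simp [adj, IntermediateField.adjoin, hF]

open Polynomial in
/-- `σ(q(t)) = q^s(at)` when `σ(t) = at` and `s` is the restriction of `σ` to `F`. -/
theorem map_aeval_eq_aeval_twist {E : Type*} [Field E] (σ : E ≃+* E) (F : Subfield E)
    (s : F →+* F) (hs : ∀ x : F, (s x : E) = σ x) (t : E) (a : F) (ht : σ t = a * t) (q : F[X]) :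
    σ (aeval t q) = aeval t ((q.map s).comp (C a * X)) := by
  induction q using Polynomial.induction_on' with
  | add p q hp hq => simp [hp, hq]
  | monomial n x =>
    have hF (x : F) : algebraMap F E x = x := rfl
    simp [ht, hF, hs, ← C_mul_X_pow_eq_monomial]

open Polynomial in
/-- `t` is transcendental over `F` if `σ(t) = at` and no power `a ^ m` with `m > 0` is of the form
`σ(g) / g`. -/
theorem transcendental_of_twist {E : Type*} [Field E] (σ : E ≃+* E)
    (F : Subfield E) (s : F →+* F) (hs : ∀ x : F, (s x : E) = σ x) {a : F} (ha : a ≠ 0)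
    (h : ∀ g : F, g ≠ 0 → ∀ m : ℕ, 0 < m → s g ≠ a ^ m * g)
    {t : E} (ht0 : t ≠ 0) (ht : σ t = a * t) :
    Transcendental F t := by
  have htwist := map_aeval_eq_aeval_twist σ F s hs t a ht
  intro halg
  obtain ⟨q, hq0, hq⟩ := halg
  obtain ⟨n, hn⟩ := exists_X_pow_mem_of_twist_stable s h ha (RingHom.ker (aeval (R := F) t))
    (fun hbot => hq0 (by simpa [hbot] using (RingHom.mem_ker (f := aeval (R := F) t)).2 hq))
    (fun p hp => by
      rw [RingHom.mem_ker] at hp ⊢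
      rw [← htwist, hp, map_zero])
  rw [RingHom.mem_ker, map_pow, aeval_X] at hn
  exact pow_ne_zero n ht0 hn

open Polynomial in
/-- The constants of `F(t)` lie in `F` if `σ(t) = at` and no power `a ^ m` with `m > 0` is of the form
`σ(g) / g`. -/
theorem mem_of_mem_adj_of_fixed {E : Type*} [Field E] (σ : E ≃+* E)
    (F : Subfield E) (s : F →+* F) (hs : ∀ x : F, (s x : E) = σ x) {a : F} (ha : a ≠ 0)
    (h : ∀ g : F, g ≠ 0 → ∀ m : ℕ, 0 < m → s g ≠ a ^ m * g)
    {t : E} (ht0 : t ≠ 0) (ht : σ t = a * t)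
    {c : E} (hc : c ∈ adj F t) (hσc : σ c = c) : c ∈ F := by
  have htwist := map_aeval_eq_aeval_twist σ F s hs t a ht
  have htr := transcendental_of_twist σ F s hs ha h ht0 ht
  rcases eq_or_ne c 0 with rfl | hc0
  · exact zero_mem F
  obtain ⟨p, q, hpq⟩ := (mem_adj_iff F t c).1 hc
  have hq : aeval t q ≠ 0 := by
    intro hq
    simp [hq] at hpq
    exact hc0 hpq
  let I : Ideal F[X] :=
    { carrier := {r | ∃ u : F[X], aeval t r * c = aeval t u}
      zero_mem' := ⟨0, by simp⟩
      add_mem' := by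
        rintro r r' ⟨u, hu⟩ ⟨u', hu'⟩
        exact ⟨u + u', by rw [map_add, map_add, add_mul, hu, hu']⟩
      smul_mem' := by
        rintro v r ⟨u, hu⟩
        exact ⟨v * u, by rw [smul_eq_mul, map_mul, map_mul, mul_assoc, hu]⟩ }
  have hqI : q ∈ I := ⟨p, by rw [hpq, mul_div_cancel₀ _ hq]⟩
  obtain ⟨n, u, hu⟩ := exists_X_pow_mem_of_twist_stable s h ha I
    (fun hbot => hq (by
      rw [hbot, Ideal.mem_bot] at hqI
      rw [hqI, map_zero]))
    (by
      rintro r ⟨u, hu⟩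
      exact ⟨(u.map s).comp (C a * X), by rw [← htwist, ← htwist, ← hu, map_mul, hσc]⟩)
  rw [map_pow, aeval_X] at hu
  have hmono := eq_C_mul_X_pow_of_twist_eq s h ha n u <| by
    apply transcendental_iff_injective.1 htr
    rw [← htwist, ← hu, map_mul, map_mul, ← hu, map_pow, ht, hσc, aeval_C, mul_pow, mul_assoc]
    rfl
  rw [hmono, map_mul, map_pow, aeval_X, aeval_C, mul_comm] at hu
  rw [mul_right_cancel₀ (pow_ne_zero n ht0) hu]
  exact (u.coeff n).2

/-- Characterization of Π-extensions: for `σ(t) = a·t + f` with `a, f ∈ F`, `a ≠ 0`,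
`F(t)` is a Π-extension of `F` iff `t ≠ 0`, `f = 0` and there is no `0 ≠ g ∈ F` and
no `m > 0` with `σ(g) = a^m·g`. -/
theorem pi_criterion {E : Type*} [Field E] [CharZero E] (σ : E ≃+* E)
    (F : Subfield E) (hF : F.map (σ : E →+* E) = F)
    (t a f : E) (ha : a ∈ F) (hf : f ∈ F) (ha0 : a ≠ 0)
    (hσt : σ t = a * t + f) :
    (Transcendental F t ∧ f = 0 ∧ constSet σ (adj F t) = constSet σ F) ↔
      (t ≠ 0 ∧ f = 0 ∧ ¬ ∃ g ∈ F, g ≠ 0 ∧ ∃ m : ℤ, 0 < m ∧ σ g = a ^ m * g) := by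
  constructor
  · rintro ⟨htr, rfl, hc⟩
    have ht0 : t ≠ 0 := by
      rintro rfl
      exact htr isAlgebraic_zero
    refine ⟨ht0, rfl, ?_⟩
    rintro ⟨g, hg, hg0, m, hm, hσg⟩
    lift m to ℕ using hm.le
    rw [zpow_natCast] at hσg
    have ht : t ∈ adj F t := Subfield.subset_closure (Or.inr rfl)
    have hmem : t ^ m / g ∈ constSet σ (adj F t) := by
      refine ⟨div_mem (pow_mem ht m) (Subfield.subset_closure (Or.inl hg)), ?_⟩
      rw [map_div₀, map_pow, hσt, hσg, add_zero, mul_pow,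
        mul_div_mul_left _ _ (pow_ne_zero m ha0)]
    rw [hc] at hmem
    have htm : t ^ m ∈ F := by
      simpa [div_mul_cancel₀ _ hg0] using mul_mem hmem.1 hg
    exact htr.pow (by exact_mod_cast hm) (isAlgebraic_algebraMap (⟨t ^ m, htm⟩ : F))
  · rintro ⟨ht0, rfl, hno⟩
    rw [add_zero] at hσt
    have hmap : ∀ x ∈ F, σ x ∈ F := fun x hx => hF ▸ ⟨x, hx, rfl⟩
    let s : F →+* F := (σ : E →+* E).restrict F F hmap
    have hs : ∀ x : F, (s x : E) = σ x := fun _ => rfl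
    let b : F := ⟨a, ha⟩
    have hb : b ≠ 0 := fun h => ha0 (congrArg Subtype.val h)
    have h : ∀ g : F, g ≠ 0 → ∀ m : ℕ, 0 < m → s g ≠ b ^ m * g := by
      intro g hg m hm hsg
      refine hno ⟨g, g.2, by simpa using hg, m, by exact_mod_cast hm, ?_⟩
      rw [← hs, hsg, zpow_natCast]
      rfl
    refine ⟨transcendental_of_twist σ F s hs hb h ht0 hσt, rfl, Set.ext fun c => ⟨fun hc => ?_,
      fun hc => ⟨Subfield.subset_closure (Or.inl hc.1), hc.2⟩⟩⟩
    exact ⟨mem_of_mem_adj_of_fixed σ F s hs hb h ht0 hσt hc.1 hc.2, hc.2⟩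
end

section
/- Let (E,σ) be a difference field extension of (F,σ) given inside E by a tower F = E₀ ⊆ E₁ ⊆ … ⊆ E_e = E where each E_i = E_{i−1}(t_i), each t_i is transcendental over E_{i−1}, const(E_i,σ) = const(F,σ) for all i, and for every i either σ(t_i) − t_i ∈ F or (t_i ≠ 0 and σ(t_i)/t_i ∈ F). Put K := const(F,σ). If g ∈ E and f ∈ F satisfy σ(g) − g = f, then there exist c₁,…,c_e ∈ K and w ∈ F with g = c₁·t₁ + … + c_e·t_e + w, and moreover c_i = 0 for every index i with σ(t_i)/t_i ∈ F. -/
section PolynomialModel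

open Polynomial

variable {E : Type*} [Field E]

theorem le_adj (G : Subfield E) (t : E) : G ≤ adj G t :=
  fun _ hx => Subfield.subset_closure (Or.inl hx)

theorem mem_adj_self (G : Subfield E) (t : E) : t ∈ adj G t :=
  Subfield.subset_closure (Or.inr rfl)

theorem adj_eq_adjoin (G : Subfield E) (t : E) :
    adj G t = (IntermediateField.adjoin G {t}).toSubfield := by
  rw [IntermediateField.adjoin_toSubfield, adj]
  congr 2
  ext x
  simp [Subfield.algebraMap_ofSubfield]

theorem aeval_mem_adj (G : Subfield E) (t : E) (p : G[X]) : aeval t p ∈ adj G t := by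
  rw [adj_eq_adjoin]
  exact IntermediateField.algebra_adjoin_le_adjoin G {t} (aeval_mem_adjoin_singleton G t)

/-- Every element of `G(t)`, with `t` transcendental, is a reduced fraction of polynomials. -/
theorem exists_coprime_monic_of_mem_adj {G : Subfield E} {t : E} (ht : Transcendental G t)
    {g : E} (hg : g ∈ adj G t) :
    ∃ p q : G[X], IsCoprime p q ∧ q.Monic ∧ aeval t q ≠ 0 ∧ g * aeval t q = aeval t p := by
  have hinj := transcendental_iff_injective.mp ht
  rw [adj_eq_adjoin] at hg
  obtain ⟨r, s, rfl⟩ := (IntermediateField.mem_adjoin_simple_iff G g).mp hg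
  have hne : ∀ q : G[X], q ≠ 0 → aeval t q ≠ 0 := fun q hq h =>
    hq (hinj (by rw [h, map_zero]))
  by_cases hs : s = 0
  · exact ⟨0, 1, isCoprime_one_right, monic_one, by simp, by simp [hs]⟩
  let x : RatFunc G := algebraMap G[X] (RatFunc G) r / algebraMap G[X] (RatFunc G) s
  have hx : x.num * s = r * x.denom := by
    apply IsFractionRing.injective G[X] (RatFunc G)
    have h := RatFunc.num_div_denom x
    have h1 : algebraMap G[X] (RatFunc G) x.denom ≠ 0 :=
      RatFunc.algebraMap_ne_zero x.denom_ne_zero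
    have h2 : algebraMap G[X] (RatFunc G) s ≠ 0 := RatFunc.algebraMap_ne_zero hs
    rw [map_mul, map_mul]
    exact (div_eq_div_iff h1 h2).mp h
  refine ⟨x.num, x.denom, x.isCoprime_num_denom, x.monic_denom, hne _ x.denom_ne_zero, ?_⟩
  have h := congrArg (aeval t) hx
  rw [map_mul, map_mul] at h
  rw [div_mul_eq_mul_div, ← h, mul_div_cancel_right₀ _ (hne s hs)]

theorem map_mem_adj {G : Subfield E} {t : E} (σ : E ≃+* E) (hG : ∀ x ∈ G, σ x ∈ G)
    (ht : σ t ∈ adj G t) : ∀ x ∈ adj G t, σ x ∈ adj G t := by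
  suffices adj G t ≤ (adj G t).comap (σ : E →+* E) from fun x hx => this hx
  refine Subfield.closure_le.mpr ?_
  rintro x (hx | rfl)
  · exact le_adj G t (hG x hx)
  · exact ht

theorem eq_C_of_aeval_mem {G : Subfield E} {t : E} (ht : Transcendental G t) {p : G[X]}
    (hp : aeval t p ∈ G) : p = C ⟨aeval t p, hp⟩ :=
  transcendental_iff_injective.mp ht (by rw [aeval_C]; rfl)

variable {G : Subfield E} {t : E} {σ : E ≃+* E} {s : G →+* G} {a b : G}

theorem aeval_map_comp (hs : ∀ x : G, (s x : E) = σ x) (hσ : σ t = a * t + b) (p : G[X]) :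
    aeval t ((p.map s).comp (C a * X + C b)) = σ (aeval t p) := by
  induction p using Polynomial.induction_on' with
  | add p q hp hq => simp only [Polynomial.map_add, add_comp, map_add, hp, hq]
  | monomial n c =>
    simp [← C_mul_X_pow_eq_monomial, Subfield.algebraMap_ofSubfield, hσ, hs]

/-- A solution of the telescoping equation in `G(t)` has a denominator which `σ` only scales. -/
theorem exists_denom_of_telescoping (hs : ∀ x : G, (s x : E) = σ x) (hσ : σ t = a * t + b)
    (ha : a ≠ 0) (ht : Transcendental G t) {g : E} (hg : g ∈ adj G t) (hf : σ g - g ∈ G) :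
    ∃ p q : G[X], q.Monic ∧ aeval t q ≠ 0 ∧ g * aeval t q = aeval t p ∧
      σ (aeval t q) = (a : E) ^ q.natDegree * aeval t q := by
  have hinj := transcendental_iff_injective.mp ht
  obtain ⟨p, q, hpq, hq, hq0, hgq⟩ := exists_coprime_monic_of_mem_adj ht hg
  refine ⟨p, q, hq, hq0, hgq, ?_⟩
  let l : G[X] := C a * X + C b
  let q' := (q.map s).comp l
  have hdeg : l.natDegree = 1 := natDegree_linear ha
  have hlead : l.leadingCoeff = a := leadingCoeff_linear ha
  have hqs : (q.map s).Monic := hq.map s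
  have hq'deg : q'.natDegree = q.natDegree := by
    rw [natDegree_comp, hdeg, mul_one, natDegree_map]
  have hq'lead : q'.leadingCoeff = a ^ q.natDegree := by
    rw [leadingCoeff_comp (by rw [hdeg]; exact one_ne_zero), hqs.leadingCoeff, one_mul,
      hlead, natDegree_map]
  have key : (p.map s).comp l * q = (p + C ⟨σ g - g, hf⟩ * q) * q' := by
    apply hinj
    rw [map_mul, map_mul, map_add, map_mul, aeval_map_comp hs hσ, aeval_map_comp hs hσ, ← hgq,
      aeval_C, map_mul]
    change _ = (_ + (σ g - g) * _) * _
    ring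
  have hdvd : q ∣ q' := by
    have h : IsCoprime q (p + C ⟨σ g - g, hf⟩ * q) := (hpq.add_mul_right_left _).symm
    exact h.dvd_of_dvd_mul_left ⟨_, by rw [← key, mul_comm]⟩
  have h := eq_leadingCoeff_mul_of_monic_of_dvd_of_natDegree_le hq hdvd hq'deg.le
  rw [← aeval_map_comp hs hσ, show (q.map s).comp (C a * X + C b) = q' from rfl, h, hq'lead]
  simp [Subfield.algebraMap_ofSubfield]

theorem telescoping_of_sigma [CharZero E] (hG : ∀ x ∈ G, σ x ∈ G) (hb : σ t - t ∈ G)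
    (ht : Transcendental G t) (hc : ∀ x ∈ adj G t, σ x = x → x ∈ G) {g : E} (hg : g ∈ adj G t)
    (hf : σ g - g ∈ G) : ∃ c ∈ G, ∃ w ∈ G, σ c = c ∧ g = c * t + w := by
  have hinj := transcendental_iff_injective.mp ht
  let s : G →+* G := (σ : E →+* E).restrict G G hG
  have hs : ∀ x : G, (s x : E) = σ x := fun _ => rfl
  have hσ : σ t = (1 : G) * t + (⟨σ t - t, hb⟩ : G) := by simp
  obtain ⟨p, q, hq, -, hgq, hσq⟩ := exists_denom_of_telescoping hs hσ one_ne_zero ht hg hf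
  have hqG : aeval t q ∈ G := hc _ (aeval_mem_adj G t q) (by simpa using hσq)
  have hq1 : q = 1 := by
    rw [eq_C_of_aeval_mem ht hqG] at hq ⊢
    rw [Monic, leadingCoeff_C] at hq
    rw [hq, C_1]
  rw [hq1, map_one, mul_one] at hgq
  subst hgq
  let l : G[X] := C 1 * X + C ⟨σ t - t, hb⟩
  have hp : (p.map s).comp l = p + C ⟨_, hf⟩ := by
    apply hinj
    rw [aeval_map_comp hs hσ, map_add, aeval_C, Subfield.algebraMap_ofSubfield]
    simp
  have hp' : ((derivative p).map s).comp l = derivative p := by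
    have h := congrArg derivative hp
    rw [derivative_comp, derivative_map] at h
    simpa [l] using h
  have hcσ : σ (aeval t (derivative p)) = aeval t (derivative p) := by
    rw [← aeval_map_comp hs hσ]
    exact congrArg (aeval t) hp'
  have hcG := hc _ (aeval_mem_adj G t _) hcσ
  have hder := eq_C_of_aeval_mem ht hcG
  set c : G := ⟨aeval t (derivative p), hcG⟩
  have hw : derivative (p - C c * X) = 0 := by simp [hder]
  have hpw := eq_C_of_natDegree_eq_zero (derivative_eq_zero.mp hw)
  refine ⟨c, c.2, _, ((p - C c * X).coeff 0).2, hcσ, ?_⟩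
  have h := congrArg (aeval t) hpw
  rw [map_sub, map_mul, aeval_C, aeval_C, aeval_X, sub_eq_iff_eq_add'] at h
  exact h

theorem telescoping_of_pi (hG : ∀ x ∈ G, σ x ∈ G) (ha : σ t / t ∈ G)
    (ht : Transcendental G t) (hc : ∀ x ∈ adj G t, σ x = x → x ∈ G) {g : E} (hg : g ∈ adj G t)
    (hf : σ g - g ∈ G) : g ∈ G := by
  have hinj := transcendental_iff_injective.mp ht
  let s : G →+* G := (σ : E →+* E).restrict G G hG
  have hs : ∀ x : G, (s x : E) = σ x := fun _ => rfl
  have ht0 : t ≠ 0 := fun h => ht (h ▸ isAlgebraic_zero)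
  obtain ⟨a, hadef⟩ : ∃ a : G, (a : E) = σ t / t := ⟨⟨_, ha⟩, rfl⟩
  have hat : σ t = a * t := by rw [hadef, div_mul_cancel₀ _ ht0]
  have ha0 : (a : E) ≠ 0 := by
    rw [hadef]
    exact div_ne_zero (by simpa using ht0) ht0
  have hσ : σ t = a * t + (0 : G) := by simp [hat]
  have hpow : ∀ (x : E) (i n : ℕ), σ x * (a : E) ^ i = a ^ n * x → x * t ^ i ∈ adj G t →
      ∃ y : G, x * t ^ i = y * t ^ n := by
    intro x i n hx hmem
    have htn : t ^ n ≠ 0 := pow_ne_zero _ ht0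
    refine ⟨⟨x * t ^ i / t ^ n, hc _ (div_mem hmem (pow_mem (mem_adj_self G t) n)) ?_⟩,
      (div_mul_cancel₀ _ htn).symm⟩
    rw [map_div₀, map_mul, map_pow, map_pow, hat, mul_pow, mul_pow, ← mul_assoc, hx, mul_assoc,
      mul_div_mul_left _ _ (pow_ne_zero _ ha0)]
  obtain ⟨p, q, hq, hq0, hgq, hσq⟩ := exists_denom_of_telescoping hs hσ
    (fun h => ha0 (by simp [h])) ht hg hf
  set n := q.natDegree
  obtain ⟨y, hy⟩ := hpow (aeval t q) 0 n (by simpa using hσq)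
    (by simpa using aeval_mem_adj G t q)
  rw [pow_zero, mul_one] at hy
  have hpcoeff : ∀ i, s (p.coeff i) * a ^ i =
      a ^ n * (p.coeff i + ⟨_, hf⟩ * (C y * X ^ n).coeff i) := by
    have h : (p.map s).comp (C a * X) = C (a ^ n) * (p + C ⟨_, hf⟩ * (C y * X ^ n)) := by
      apply hinj
      have h := aeval_map_comp hs hσ p
      rw [C_0, add_zero] at h
      rw [h, ← hgq, map_mul, hσq, hy, map_mul, map_add, map_mul, map_mul, ← hgq, hy, map_pow,
        map_pow, map_pow, aeval_X, aeval_C, aeval_C, aeval_C]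
      simp only [Subfield.algebraMap_ofSubfield, Subfield.subtype_apply]
      ring
    intro i
    rw [← coeff_C_mul, ← coeff_add, ← coeff_C_mul, ← h, comp_C_mul_X_coeff, coeff_map]
  have hp : p = C (p.coeff n) * X ^ n := by
    ext1 i
    rw [coeff_C_mul_X_pow]
    split_ifs with hi
    · rw [hi]
    have h := hpcoeff i
    rw [coeff_C_mul_X_pow, if_neg hi, mul_zero, add_zero] at h
    obtain ⟨z, hz⟩ := hpow (p.coeff i) i n (congrArg Subtype.val h)
      (mul_mem (le_adj G t (p.coeff i).2) (pow_mem (mem_adj_self G t) i))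
    have hz' : C (p.coeff i) * X ^ i = C z * X ^ n := by
      apply hinj
      simpa [Subfield.algebraMap_ofSubfield] using hz
    have := congrArg (fun r => coeff r i) hz'
    simpa [coeff_X_pow, hi] using this
  have hgy : g * y = p.coeff n := by
    have h := hgq
    rw [hp, hy, map_mul, map_pow, aeval_X, aeval_C, ← mul_assoc] at h
    exact mul_right_cancel₀ (pow_ne_zero _ ht0) h
  have hy0 : (y : E) ≠ 0 := fun h => hq0 (by rw [hy, h, zero_mul])
  rw [eq_div_of_mul_eq hy0 hgy]
  exact div_mem (p.coeff n).2 y.2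

end PolynomialModel

/-- The step from `G(t)` to `G` in a `ΠΣ`-extension. -/
theorem telescoping_step {E : Type*} [Field E] [CharZero E] {σ : E ≃+* E} {G : Subfield E} {t : E}
    (hG : ∀ x ∈ G, σ x ∈ G) (ht : Transcendental G t) (hc : ∀ x ∈ adj G t, σ x = x → x ∈ G)
    (hPS : σ t - t ∈ G ∨ σ t / t ∈ G) {g : E} (hg : g ∈ adj G t) (hf : σ g - g ∈ G) :
    ∃ c ∈ G, ∃ w ∈ G, σ c = c ∧ g = c * t + w ∧ (σ t / t ∈ G → c = 0) := by
  by_cases ha : σ t / t ∈ G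
  · exact ⟨0, zero_mem G, g, telescoping_of_pi hG ha ht hc hg hf, map_zero σ, by simp,
      fun _ => rfl⟩
  · obtain ⟨c, hcG, w, hw, hσc, h⟩ :=
      telescoping_of_sigma hG (hPS.resolve_right ha) ht hc hg hf
    exact ⟨c, hcG, w, hw, hσc, h, fun h => absurd h ha⟩

/-- The solution structure for `g` in an intermediate level `T n` of the tower. -/
theorem telescoping_of_mem_tower {E : Type*} [Field E] [CharZero E] (σ : E ≃+* E)
    (F : Subfield E) (T : ℕ → Subfield E) (t : ℕ → E) (hT0 : T 0 = F)
    (hF : ∀ x ∈ F, σ x ∈ F) (n : ℕ)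
    (hadj : ∀ i < n, T (i + 1) = adj (T i) (t i))
    (htr : ∀ i < n, Transcendental (T i) (t i))
    (hconst : ∀ i ≤ n, constSet σ (T i) = constSet σ F)
    (hPS : ∀ i < n, σ (t i) - t i ∈ F ∨ σ (t i) / t i ∈ F) :
    F ≤ T n ∧ (∀ x ∈ T n, σ x ∈ T n) ∧ ∀ g ∈ T n, σ g - g ∈ F →
      ∃ (c : ℕ → E) (w : E), w ∈ F ∧ (∀ i < n, c i ∈ constSet σ F) ∧
        g = (∑ i ∈ Finset.range n, c i * t i) + w ∧
        ∀ i < n, σ (t i) / t i ∈ F → c i = 0 := by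
  induction n with
  | zero =>
    subst hT0
    exact ⟨le_rfl, hF, fun g hg _ => ⟨0, g, hg, by simp, by simp, by simp⟩⟩
  | succ n ih =>
    obtain ⟨hFT, hσT, ih⟩ := ih (fun i hi => hadj i (hi.trans n.lt_succ_self))
      (fun i hi => htr i (hi.trans n.lt_succ_self))
      (fun i hi => hconst i (hi.trans n.le_succ)) (fun i hi => hPS i (hi.trans n.lt_succ_self))
    have hn := n.lt_succ_self
    have ht := htr n hn
    have ht0 : t n ≠ 0 := fun h => ht (h ▸ isAlgebraic_zero)
    have htmem := mem_adj_self (T n) (t n)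
    have hle := le_adj (T n) (t n)
    rw [hadj n hn]
    refine ⟨hFT.trans hle, map_mem_adj σ hσT ?_, fun g hg hgF => ?_⟩
    · rcases hPS n hn with h | h
      · simpa using add_mem (hle (hFT h)) htmem
      · simpa [ht0] using mul_mem (hle (hFT h)) htmem
    have hc : ∀ x ∈ adj (T n) (t n), σ x = x → x ∈ T n := by
      intro x hx hσx
      rw [← hadj n hn] at hx
      have h : x ∈ constSet σ (T (n + 1)) := ⟨hx, hσx⟩
      rw [hconst _ le_rfl] at h
      exact hFT h.1
    obtain ⟨d, hd, v, hv, hσd, hgv, hd0⟩ := telescoping_step hσT ht hc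
      ((hPS n hn).imp (fun h => hFT h) (fun h => hFT h)) hg (hFT hgF)
    have hdF : d ∈ constSet σ F := by
      rw [← hconst n n.le_succ]
      exact ⟨hd, hσd⟩
    have hvF : σ v - v ∈ F := by
      rcases hPS n hn with h | h
      · have := sub_mem hgF (mul_mem hdF.1 h)
        rw [hgv, map_add, map_mul, hσd] at this
        convert this using 1
        ring
      · simpa [hgv, hd0 (hFT h)] using hgF
    obtain ⟨c, w, hw, hcF, hsum, hc0⟩ := ih v hv hvF
    refine ⟨Function.update c n d, w, hw, fun i hi => ?_, ?_, fun i hi h => ?_⟩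
    · rcases (Nat.lt_succ_iff_lt_or_eq.mp hi) with hi | rfl
      · simpa [hi.ne] using hcF i hi
      · simpa using hdF
    · have h : ∀ i ∈ Finset.range n, Function.update c n d i * t i = c i * t i := fun i hi => by
        rw [Function.update_of_ne (Finset.mem_range.mp hi).ne]
      rw [Finset.sum_range_succ, Finset.sum_congr rfl h, Function.update_self, hgv, hsum]
      ring
    · rcases (Nat.lt_succ_iff_lt_or_eq.mp hi) with hi | rfl
      · simpa [hi.ne] using hc0 i hi h
      · simpa using hd0 (hFT h)

/-- Structure of telescoping solutions in a ΠΣ*-extension whose generators `tᵢ`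
have `σ(tᵢ) - tᵢ ∈ F` or `σ(tᵢ)/tᵢ ∈ F`: any solution `g` of `σ(g) - g = f` with
`f ∈ F` has the form `g = c₁·t₁ + … + c_e·t_e + w` with constants `cᵢ` and `w ∈ F`,
where `cᵢ = 0` whenever `σ(tᵢ)/tᵢ ∈ F`. -/
theorem telescoping_solution_structure {E : Type*} [Field E] [CharZero E] (σ : E ≃+* E)
    (F : Subfield E) (hF : F.map (σ : E →+* E) = F)
    (e : ℕ) (T : ℕ → Subfield E) (t : ℕ → E)
    (hT0 : T 0 = F) (hTe : T e = ⊤)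
    (hadj : ∀ i < e, T (i + 1) = adj (T i) (t i))
    (htr : ∀ i < e, Transcendental (T i) (t i))
    (hconst : ∀ i ≤ e, constSet σ (T i) = constSet σ F)
    (hPS : ∀ i < e, σ (t i) - t i ∈ F ∨ (t i ≠ 0 ∧ σ (t i) / t i ∈ F))
    (g f : E) (hfF : f ∈ F) (hg : σ g - g = f) :
    ∃ (c : ℕ → E) (w : E), w ∈ F ∧ (∀ i < e, c i ∈ constSet σ F) ∧
      g = (∑ i ∈ Finset.range e, c i * t i) + w ∧
      ∀ i < e, σ (t i) / t i ∈ F → c i = 0 := by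
  have hσF : ∀ x ∈ F, σ x ∈ F := fun x hx =>
    hF.le (Subfield.mem_map.mpr ⟨x, hx, rfl⟩)
  obtain ⟨-, -, h⟩ := telescoping_of_mem_tower σ F T t hT0 hσF e hadj htr hconst
    fun i hi => (hPS i hi).imp_right And.right
  exact h g (by simp [hTe]) (hg ▸ hfF)
end

section
/- Let (F,σ) and (F',σ') be difference fields of characteristic zero and τ : F → F' a σ-isomorphism, i.e. a field isomorphism with σ'(τ(x)) = τ(σ(x)) for all x ∈ F. Let F(t) be a Σ*-extension of (F,σ) with β := σ(t) − t ∈ F nonzero, and let F'(t') be a Σ*-extension of (F',σ'). Suppose g ∈ F'(t') with g ∉ F' satisfies σ'(g) − g = τ(β). Then there exists a field isomorphism τ' : F(t) → F'(t') with τ'(t) = g, τ'(x) = τ(x) for all x ∈ F, and σ'(τ'(u)) = τ'(σ(u)) for all u ∈ F(t). -/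
open Polynomial IntermediateField

section ShiftExtension

variable {K L : Type*} [Field K] [Field L] [Algebra K L]

/-- The action of `S` on polynomials in `t` is a twisted Taylor shift. -/
theorem aeval_taylor_map_eq
    (s : K →+* K) (S : L →+* L) (hS : ∀ x, S (algebraMap K L x) = algebraMap K L (s x))
    {t : L} {b : K} (hSt : S t = t + algebraMap K L b) (p : K[X]) :
    aeval t (taylor b (p.map s)) = S (aeval t p) := by
  induction p using Polynomial.induction_on' with
  | add p q hp hq => simp [hp, hq]
  | monomial n a => simp [taylor_monomial, aeval_monomial, hS, hSt]

/-- An element of `K(t)` whose difference `S g - g` lies in `K` is a polynomial in `t`. -/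
theorem exists_eq_aeval_of_shift
    (s : K →+* K) (S : L →+* L) (hS : ∀ x, S (algebraMap K L x) = algebraMap K L (s x))
    {t : L} {b : K} (hSt : S t = t + algebraMap K L b) (ht : Transcendental K t)
    (hconst : ∀ c ∈ K⟮t⟯, S c = c → c ∈ Set.range (algebraMap K L))
    {g : L} (hg : g ∈ K⟮t⟯) {d : K}
    (hSg : S g = g + algebraMap K L d) : ∃ p : K[X], g = aeval t p := by
  have hinj := transcendental_iff_injective.mp ht
  have hne : ∀ q : K[X], q ≠ 0 → aeval t q ≠ 0 := fun q hq h => hq (hinj (by simpa using h))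
  have monic_of_ne : ∀ q p : K[X], q ≠ 0 → aeval t q * g = aeval t p →
      ∃ q' : K[X], q'.Monic ∧ q'.natDegree = q.natDegree ∧ ∃ p' : K[X], aeval t q' * g = aeval t p' := by
    intro q p hq h
    refine ⟨q * C q.leadingCoeff⁻¹, monic_mul_leadingCoeff_inv hq,
      natDegree_mul_leadingCoeff_inv q hq, p * C q.leadingCoeff⁻¹, ?_⟩
    simp only [map_mul, ← h]
    ring
  let P : ℕ → Prop := fun n =>
    ∃ q : K[X], q.Monic ∧ q.natDegree = n ∧ ∃ p : K[X], aeval t q * g = aeval t p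
  have hP : ∃ n, P n := by
    obtain ⟨r, q, h⟩ := (mem_adjoin_simple_iff K g).mp hg
    by_cases hq : q = 0
    · exact ⟨0, 1, monic_one, natDegree_one, 0, by simp [h, hq]⟩
    · obtain ⟨q', h1, h2, h3⟩ := monic_of_ne q r hq (by rw [h]; field_simp [hne q hq])
      exact ⟨_, q', h1, rfl, h3⟩
  classical
  obtain ⟨q, hqm, hqd, p, hqp⟩ := Nat.find_spec hP
  have hshift := congrArg S hqp
  set q' := taylor b (q.map s) with hq'
  have hSq : S (aeval t q) = aeval t q' := (aeval_taylor_map_eq s S hS hSt q).symm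
  rw [map_mul, hSg, hSq, ← aeval_taylor_map_eq s S hS hSt] at hshift
  have hdeg' : q'.degree = q.degree := by
    rw [hq', degree_taylor, degree_map]
  have hmon' : q'.leadingCoeff = 1 := by
    rw [hq', leadingCoeff_taylor, leadingCoeff_map, hqm.leadingCoeff, map_one]
  have hfix : q' = q := by
    by_contra hqq
    obtain ⟨r, h1, h2, h3⟩ := monic_of_ne (q' - q) (taylor b (p.map s) - q' * C d - p)
      (sub_ne_zero.mpr hqq) (by
        simp only [map_sub, map_mul, aeval_C, ← hshift, ← hqp]
        ring)
    have hlt : (q' - q).degree < q'.degree :=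
      degree_sub_lt_left hdeg' (by rw [← degree_ne_bot, hdeg', degree_ne_bot]; exact hqm.ne_zero)
        (by rw [hmon', hqm.leadingCoeff])
    have hlt' := natDegree_lt_natDegree (sub_ne_zero.mpr hqq) (hdeg' ▸ hlt)
    exact Nat.find_min hP (by omega : r.natDegree < Nat.find hP) ⟨r, h1, rfl, h3⟩
  obtain ⟨c, hc⟩ := hconst (aeval t q)
    ((mem_adjoin_simple_iff K _).mpr ⟨q, 1, by simp⟩) (by rw [hSq, hfix])
  have hc0 : c ≠ 0 := by
    rintro rfl
    exact hne q hqm.ne_zero (by simpa using hc.symm)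
  refine ⟨C c⁻¹ * p, ?_⟩
  rw [map_mul, ← hqp, ← hc, aeval_C, ← mul_assoc, ← map_mul, inv_mul_cancel₀ hc0, map_one, one_mul]

/-- A polynomial in `t` whose difference lies in `K` is at most linear. -/
theorem natDegree_le_one_of_shift [CharZero K]
    (s : K →+* K) (S : L →+* L) (hS : ∀ x, S (algebraMap K L x) = algebraMap K L (s x))
    {t : L} {b : K} (hSt : S t = t + algebraMap K L b) (ht : Transcendental K t)
    (hconst : ∀ c ∈ K⟮t⟯, S c = c → c ∈ Set.range (algebraMap K L))
    {p : K[X]} {d : K}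
    (hSp : S (aeval t p) = aeval t p + algebraMap K L d) : p.natDegree ≤ 1 := by
  have hinj := transcendental_iff_injective.mp ht
  have hp : taylor b (p.map s) = p + C d := by
    apply hinj
    rw [aeval_taylor_map_eq s S hS hSt, hSp, map_add, aeval_C]
  by_contra! hdeg
  obtain ⟨n, hn⟩ : ∃ n, p.natDegree = n + 2 := ⟨p.natDegree - 2, by omega⟩
  have ha0 : p.coeff (n + 2) ≠ 0 := by
    rw [← hn]
    exact leadingCoeff_ne_zero.mpr (by rintro rfl; simp at hn)
  have hlead : s (p.coeff (n + 2)) = p.coeff (n + 2) := by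
    have h := congrArg (fun f => coeff f (n + 2)) hp
    have hnat : (p.map s).natDegree = n + 2 := by rw [natDegree_map, hn]
    simp only [coeff_add, coeff_C_succ, add_zero] at h
    rw [← hnat, coeff_taylor_natDegree, leadingCoeff, hnat, coeff_map] at h
    exact h
  have hnext : s (p.coeff (n + 1)) + (n + 2) * s (p.coeff (n + 2)) * b = p.coeff (n + 1) := by
    have h := congrArg (fun f => coeff f (n + 1)) hp
    have hnat : (hasseDeriv (n + 1) (p.map s)).natDegree < 2 := by
      have := natDegree_hasseDeriv_le (p.map s) (n + 1)
      rw [natDegree_map, hn] at this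
      omega
    simp only [coeff_add, coeff_C_succ, add_zero, taylor_coeff] at h
    rw [eval_eq_sum_range' hnat] at h
    simp only [Finset.sum_range_succ, hasseDeriv_coeff, coeff_map, Finset.sum_range_zero,
      zero_add, Nat.choose_self, Nat.cast_one, one_mul, pow_zero, mul_one, pow_one,
      Nat.add_comm 1 (n + 1), Nat.choose_succ_self_right] at h
    rw [show n + 1 + 1 = n + 2 from rfl] at h
    push_cast at h
    exact h
  set a := p.coeff (n + 2)
  set a₁ := p.coeff (n + 1)
  have hn0 : (n + 2 : K) ≠ 0 := by exact_mod_cast (by omega : n + 2 ≠ 0)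
  set w := a₁ / ((n + 2) * a)
  have hw : s w + b = w := by
    simp only [w, map_div₀, map_mul, map_add, map_natCast, map_ofNat, hlead]
    rw [hlead] at hnext
    field_simp
    linear_combination hnext
  obtain ⟨c, hc⟩ := hconst (t + algebraMap K L w)
    (add_mem (mem_adjoin_simple_self K t) (IntermediateField.algebraMap_mem _ w)) (by
      rw [map_add, hSt, hS]
      nth_rw 2 [← hw]
      rw [map_add]
      ring)
  refine ht ?_
  rw [show t = algebraMap K L (c - w) by rw [map_sub, hc, add_sub_cancel_right]]
  exact isAlgebraic_algebraMap _

/-- If `S g - g ∈ K` for `g ∈ K(t)`, then `g = a t + w` with `a, w ∈ K`. -/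
theorem exists_eq_linear_of_shift [CharZero K]
    (s : K →+* K) (S : L →+* L) (hS : ∀ x, S (algebraMap K L x) = algebraMap K L (s x))
    {t : L} {b : K} (hSt : S t = t + algebraMap K L b) (ht : Transcendental K t)
    (hconst : ∀ c ∈ K⟮t⟯, S c = c → c ∈ Set.range (algebraMap K L))
    {g : L} (hg : g ∈ K⟮t⟯) {d : K}
    (hSg : S g = g + algebraMap K L d) :
    ∃ a w : K, g = algebraMap K L a * t + algebraMap K L w := by
  obtain ⟨p, rfl⟩ := exists_eq_aeval_of_shift s S hS hSt ht hconst hg hSg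
  have hp := natDegree_le_one_of_shift s S hS hSt ht hconst hSg
  refine ⟨p.coeff 1, p.coeff 0, ?_⟩
  conv_lhs => rw [eq_X_add_C_of_natDegree_le_one hp]
  simp

end ShiftExtension

/-- Simple transcendental extensions are isomorphic by matching generators. -/
theorem exists_algEquiv_adjoin_of_transcendental {K L L' : Type*} [Field K] [Field L] [Field L']
    [Algebra K L] [Algebra K L'] {t : L} {g : L'} (ht : Transcendental K t)
    (hg : Transcendental K g) :
    ∃ e : K⟮t⟯ ≃ₐ[K] K⟮g⟯, e (AdjoinSimple.gen K t) = AdjoinSimple.gen K g := by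
  refine ⟨(RatFunc.algEquivOfTranscendental t ht).symm.trans
    (RatFunc.algEquivOfTranscendental g hg), ?_⟩
  have h := RatFunc.algEquivOfTranscendental_symm_aeval t ht X
  rw [aeval_X] at h
  rw [AlgEquiv.trans_apply, h, RatFunc.algebraMap_X]
  exact Subtype.ext (RatFunc.algEquivOfTranscendental_X g hg)

theorem mem_adj_iff_mem_adjoin {K E : Type*} [Field K] [Field E] [Algebra K E] {F : Subfield E}
    (hF : Set.range (algebraMap K E) = F) (t x : E) : x ∈ adj F t ↔ x ∈ K⟮t⟯ := by
  rw [← mem_toSubfield, adjoin_toSubfield, hF, adj]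

theorem range_algebraMap_subfield {E : Type*} [Field E] (F : Subfield E) :
    Set.range (algebraMap F E) = F := Subtype.range_coe

/-- Lifting a σ-isomorphism `τ : F → F'` along Σ*-extensions `F(t)` and `F'(t')`:
if `g ∈ F'(t') \ F'` satisfies `σ'(g) - g = τ(σ(t) - t)`, then `τ` extends to a
σ-isomorphism `τ' : F(t) → F'(t')` with `τ'(t) = g`.  Here field isomorphisms between
subfields are encoded as functions on the ambient fields that are injective ring
homomorphisms on (and surjective onto) the relevant subfields. -/
theorem sigma_isomorphism_lift {E E' : Type*} [Field E] [Field E'] [CharZero E] [CharZero E']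
    (σ : E ≃+* E) (σ' : E' ≃+* E')
    (F : Subfield E) (hF : F.map (σ : E →+* E) = F)
    (F' : Subfield E') (hF' : F'.map (σ' : E' →+* E') = F')
    -- τ is a σ-isomorphism from F onto F'
    (τ : E → E')
    (hτmaps : ∀ x ∈ F, τ x ∈ F')
    (hτinj : Set.InjOn τ (F : Set E))
    (hτsurj : τ '' (F : Set E) = (F' : Set E'))
    (hτadd : ∀ x ∈ F, ∀ y ∈ F, τ (x + y) = τ x + τ y)
    (hτmul : ∀ x ∈ F, ∀ y ∈ F, τ (x * y) = τ x * τ y)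
    (hτone : τ 1 = 1)
    (hτσ : ∀ x ∈ F, σ' (τ x) = τ (σ x))
    -- F(t) is a Σ*-extension of F
    (t : E) (htrans : Transcendental F t)
    (hβ : σ t - t ∈ F) (hβ0 : σ t - t ≠ 0)
    (hconst : constSet σ (adj F t) = constSet σ F)
    -- F'(t') is a Σ*-extension of F'
    (t' : E') (htrans' : Transcendental F' t')
    (hβ' : σ' t' - t' ∈ F') (hβ'0 : σ' t' - t' ≠ 0)
    (hconst' : constSet σ' (adj F' t') = constSet σ' F')
    -- g ∈ F'(t') \ F' with σ'(g) - g = τ(σ(t) - t)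
    (g : E') (hgmem : g ∈ adj F' t') (hgnot : g ∉ F')
    (hgtel : σ' g - g = τ (σ t - t)) :
    ∃ τ' : E → E',
      (∀ x ∈ adj F t, τ' x ∈ adj F' t') ∧
      Set.InjOn τ' ((adj F t : Subfield E) : Set E) ∧
      τ' '' ((adj F t : Subfield E) : Set E) = ((adj F' t' : Subfield E') : Set E') ∧
      (∀ x ∈ adj F t, ∀ y ∈ adj F t, τ' (x + y) = τ' x + τ' y) ∧
      (∀ x ∈ adj F t, ∀ y ∈ adj F t, τ' (x * y) = τ' x * τ' y) ∧
      τ' 1 = 1 ∧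
      τ' t = g ∧
      (∀ x ∈ F, τ' x = τ x) ∧
      (∀ u ∈ adj F t, σ' (τ' u) = τ' (σ u)) := by
  have hσF' : ∀ x ∈ F', σ' x ∈ F' := fun x hx => hF' ▸ Subfield.mem_map.mpr ⟨x, hx, rfl⟩
  have hτβ : τ (σ t - t) ∈ F' := hτmaps _ hβ
  let s' : F' →+* F' := ((σ' : E' →+* E').comp F'.subtype).codRestrict F' fun x => hσF' x x.2
  have hmem' := mem_adj_iff_mem_adjoin (range_algebraMap_subfield F')
  have hmem := mem_adj_iff_mem_adjoin (range_algebraMap_subfield F)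
  obtain ⟨⟨a, ha⟩, ⟨w, hw⟩, hgaw⟩ := exists_eq_linear_of_shift s' (σ' : E' →+* E') (fun _ => rfl)
    (b := ⟨_, hβ'⟩) (show σ' t' = t' + (σ' t' - t') by ring) htrans'
    (fun c hc hσc => by
      have h : c ∈ constSet σ' (adj F' t') := ⟨(hmem' t' c).mpr hc, hσc⟩
      rw [hconst'] at h
      exact ⟨⟨c, h.1⟩, rfl⟩)
    ((hmem' t' g).mp hgmem) (d := ⟨_, hτβ⟩) (show σ' g = g + τ (σ t - t) by rw [← hgtel]; ring)
  replace hgaw : g = a * t' + w := hgaw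
  have ha0 : a ≠ 0 := by
    rintro rfl
    exact hgnot (by simpa [hgaw] using hw)
  have ht'g : t' = a⁻¹ * (g - w) := by
    rw [hgaw]
    field_simp
    ring
  have hsubset : ∀ u : E', (F' : Set E') ⊆ adj F' u := fun u x hx =>
    Subfield.subset_closure (Or.inl hx)
  have hself : ∀ u : E', u ∈ adj F' u := fun u => Subfield.subset_closure (Or.inr rfl)
  have hadj : adj F' g = adj F' t' := by
    apply le_antisymm
    · refine Subfield.closure_le.mpr (Set.union_subset (hsubset t') ?_)
      rintro _ rfl
      exact hgmem
    · refine Subfield.closure_le.mpr (Set.union_subset (hsubset g) ?_)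
      rintro _ rfl
      rw [SetLike.mem_coe, ht'g]
      exact mul_mem (inv_mem (hsubset g ha)) (sub_mem (hself g) (hsubset g hw))
  have hgtrans : Transcendental F' g := by
    intro hg
    refine htrans' ?_
    rw [ht'g]
    have h1 : IsAlgebraic F' a := isAlgebraic_algebraMap (⟨a, ha⟩ : F')
    have h2 : IsAlgebraic F' w := isAlgebraic_algebraMap (⟨w, hw⟩ : F')
    exact h1.inv.mul (hg.sub h2)
  let τF : F →+* F' :=
    { toFun := fun x => ⟨τ x, hτmaps x x.2⟩
      map_one' := Subtype.ext hτone
      map_mul' := fun x y => Subtype.ext (hτmul x x.2 y y.2)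
      map_zero' := Subtype.ext (by simpa using hτadd 0 F.zero_mem 0 F.zero_mem)
      map_add' := fun x y => Subtype.ext (hτadd x x.2 y y.2) }
  let _ : Algebra F E' := (F'.subtype.comp τF).toAlgebra
  have hgtrans' : Transcendental F g := by
    rw [transcendental_iff_injective] at hgtrans ⊢
    have h : ∀ p : F[X], aeval g p = aeval g (p.map τF) := fun p => by
      rw [aeval_def, aeval_def, eval₂_map]
      rfl
    intro p q hpq
    rw [h, h] at hpq
    exact map_injective τF τF.injective (hgtrans hpq)
  obtain ⟨e, he⟩ := exists_algEquiv_adjoin_of_transcendental htrans hgtrans'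
  have hrange : Set.range (algebraMap F E') = F' := by
    ext y
    constructor
    · rintro ⟨x, rfl⟩
      exact hτmaps x x.2
    · intro hy
      rw [← hτsurj] at hy
      obtain ⟨x, hx, rfl⟩ := hy
      exact ⟨⟨x, hx⟩, rfl⟩
  have hmemg : ∀ y, y ∈ adj F' t' ↔ y ∈ (F⟮g⟯ : IntermediateField F E') := fun y => by
    rw [← hadj]
    exact mem_adj_iff_mem_adjoin hrange g y
  have hσe : ∀ u (hu : u ∈ F⟮t⟯), ∃ hu' : σ u ∈ F⟮t⟯, σ' (e ⟨u, hu⟩) = e ⟨σ u, hu'⟩ := by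
    have hef : ∀ x (hx : x ∈ F) (hx' : x ∈ F⟮t⟯), (e ⟨x, hx'⟩ : E') = τ x := fun x hx hx' =>
      congrArg Subtype.val (e.commutes ⟨x, hx⟩)
    have hσF : ∀ x ∈ F, σ x ∈ F := fun x hx => hF ▸ Subfield.mem_map.mpr ⟨x, hx, rfl⟩
    have hF_le : ∀ x ∈ F, x ∈ F⟮t⟯ := fun x hx =>
      IntermediateField.algebraMap_mem _ (⟨x, hx⟩ : F)
    intro u hu
    induction hu using IntermediateField.adjoin_induction with
    | mem x hx =>
      obtain rfl : x = t := hx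
      have hσt : σ x = x + (σ x - x) := by ring
      refine ⟨hσt ▸ add_mem (mem_adjoin_simple_self F x) (hF_le _ hβ), ?_⟩
      have h1 : (e ⟨x, mem_adjoin_simple_self F x⟩ : E') = g := congrArg Subtype.val he
      have h2 : (⟨σ x, hσt ▸ add_mem (mem_adjoin_simple_self F x) (hF_le _ hβ)⟩ : F⟮x⟯) =
          ⟨x, mem_adjoin_simple_self F x⟩ + ⟨σ x - x, hF_le _ hβ⟩ := Subtype.ext hσt
      rw [h2, map_add, IntermediateField.coe_add, h1, hef _ hβ, ← hgtel]
      ring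
    | algebraMap x =>
      refine ⟨hF_le _ (hσF x x.2), ?_⟩
      exact (congrArg σ' (hef x x.2 _)).trans
        ((hτσ x x.2).trans (hef _ (hσF x x.2) _).symm)
    | add x y hx hy ihx ihy =>
      obtain ⟨hx', h1⟩ := ihx
      obtain ⟨hy', h2⟩ := ihy
      refine ⟨map_add σ x y ▸ add_mem hx' hy', ?_⟩
      rw [← AddMemClass.mk_add_mk _ x y hx hy, map_add, IntermediateField.coe_add, map_add, h1, h2,
        ← IntermediateField.coe_add, ← map_add]
      exact congrArg (fun z => (e z : E')) (Subtype.ext (map_add σ x y).symm)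
    | mul x y hx hy ihx ihy =>
      obtain ⟨hx', h1⟩ := ihx
      obtain ⟨hy', h2⟩ := ihy
      refine ⟨map_mul σ x y ▸ mul_mem hx' hy', ?_⟩
      rw [← MulMemClass.mk_mul_mk _ x y hx hy, map_mul, IntermediateField.coe_mul, map_mul, h1, h2,
        ← IntermediateField.coe_mul, ← map_mul]
      exact congrArg (fun z => (e z : E')) (Subtype.ext (map_mul σ x y).symm)
    | inv x hx ihx =>
      obtain ⟨hx', h1⟩ := ihx
      refine ⟨map_inv₀ σ x ▸ inv_mem hx', ?_⟩
      rw [show (⟨x⁻¹, inv_mem hx⟩ : F⟮t⟯) = ⟨x, hx⟩⁻¹ from rfl, map_inv₀, IntermediateField.coe_inv,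
        map_inv₀, h1, ← IntermediateField.coe_inv, ← map_inv₀]
      exact congrArg (fun z => (e z : E')) (Subtype.ext (map_inv₀ σ x).symm)
  classical
  let τ' : E → E' := fun x => if hx : x ∈ F⟮t⟯ then e ⟨x, hx⟩ else 0
  have hτ' : ∀ x (hx : x ∈ F⟮t⟯), τ' x = e ⟨x, hx⟩ := fun x hx => dif_pos hx
  refine ⟨τ', fun x hx => ?_, fun x hx y hy hxy => ?_, ?_, fun x hx y hy => ?_,
    fun x hx y hy => ?_, ?_, ?_, fun x hx => ?_, fun u hu => ?_⟩
  · rw [hτ' x ((hmem t x).mp hx), hmemg]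
    exact Subtype.prop _
  · rw [hτ' x ((hmem t x).mp hx), hτ' y ((hmem t y).mp hy)] at hxy
    exact congrArg Subtype.val (e.injective (Subtype.ext hxy))
  · ext y
    constructor
    · rintro ⟨x, hx, rfl⟩
      rw [hτ' x ((hmem t x).mp hx), SetLike.mem_coe, hmemg]
      exact Subtype.prop _
    · intro hy
      refine ⟨e.symm ⟨y, (hmemg y).mp hy⟩, (hmem t _).mpr (Subtype.prop _), ?_⟩
      rw [hτ' _ (Subtype.prop _), Subtype.coe_eta, AlgEquiv.apply_symm_apply]
  · rw [hmem] at hx hy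
    rw [hτ' x hx, hτ' y hy, hτ' _ (add_mem hx hy), ← IntermediateField.coe_add, ← map_add]
    rfl
  · rw [hmem] at hx hy
    rw [hτ' x hx, hτ' y hy, hτ' _ (mul_mem hx hy), ← IntermediateField.coe_mul, ← map_mul]
    rfl
  · rw [hτ' 1 (one_mem _)]
    exact congrArg Subtype.val (map_one e)
  · rw [hτ' t (mem_adjoin_simple_self F t)]
    exact congrArg Subtype.val he
  · rw [hτ' x (IntermediateField.algebraMap_mem _ (⟨x, hx⟩ : F))]
    exact congrArg Subtype.val (e.commutes ⟨x, hx⟩)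
  · rw [hmem] at hu
    obtain ⟨hu', h⟩ := hσe u hu
    rw [hτ' u hu, hτ' _ hu', h]
end

section
/- For every natural number m, Σ_{k=0}^m binom(m,k)·H_k = 2^m·(H_m − Σ_{i=1}^m 1/(i·2^i)) holds in ℚ. -/
/-- `Σ_{k=0}^m binom(m,k)/(k+1) = (2^(m+1) - 1)/(m+1)` in ℚ. -/
theorem sum_range_choose_div_succ (m : ℕ) :
    ∑ k ∈ Finset.range (m + 1), (Nat.choose m k : ℚ) * (1 / ((k + 1 : ℕ) : ℚ)) =
      (2 ^ (m + 1) - 1) / (m + 1) := by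
  have hsum : ∑ k ∈ Finset.range (m + 2), ((m + 1).choose k : ℚ) = 2 ^ (m + 1) :=
    mod_cast Nat.sum_range_choose (m + 1)
  rw [Finset.sum_range_succ'] at hsum
  rw [eq_div_iff (by positivity), Finset.sum_mul, ← hsum, Nat.choose_zero_right,
    Nat.cast_one, add_sub_cancel_right]
  refine Finset.sum_congr rfl fun k _ => ?_
  have h : ((m : ℚ) + 1) * m.choose k = (m + 1).choose (k + 1) * (k + 1) :=
    mod_cast Nat.add_one_mul_choose_eq m k
  push_cast
  field_simp
  linarith

/-- `Σ_{k=0}^m binom(m,k)·H_k = 2^m·(H_m − Σ_{i=1}^m 1/(i·2^i))` in ℚ. -/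
theorem binom_harmonic_sum (m : ℕ) :
    (∑ k ∈ Finset.range (m + 1),
        (Nat.choose m k : ℚ) * ∑ j ∈ Finset.Icc 1 k, (1 / (j : ℚ))) =
      2 ^ m * ((∑ j ∈ Finset.Icc 1 m, (1 / (j : ℚ))) -
        ∑ i ∈ Finset.Icc 1 m, 1 / ((i : ℚ) * 2 ^ i)) := by
  induction m with
  | zero => simp
  | succ m ih =>
    rw [Finset.sum_choose_succ_mul (fun k _ => ∑ j ∈ Finset.Icc 1 k, (1 / (j : ℚ))) m]
    simp only [Finset.sum_Icc_succ_top (Nat.le_add_left 1 _), mul_add, Finset.sum_add_distrib]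
    rw [ih, sum_range_choose_div_succ]
    push_cast
    field_simp
    ring
end

section
/- Define S(m) := Σ_{k=0}^m binom(m,k)·H_k in ℚ. Then for every natural number m, the first-order recurrence S(m+1) − 2·S(m) = (2^{m+1} − 1)/(m + 1) holds. -/
namespace PaperStmt18

/-- The harmonic number `H_k = Σ_{j=1}^k 1/j` in ℚ. -/
def H (k : ℕ) : ℚ := ∑ j ∈ Finset.Icc 1 k, 1 / (j : ℚ)

/-- `S(m) = Σ_{k=0}^m binom(m,k)·H_k` in ℚ. -/
def S (m : ℕ) : ℚ := ∑ k ∈ Finset.range (m + 1), (Nat.choose m k : ℚ) * H k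

theorem H_zero : H 0 = 0 := by simp [H]

theorem H_succ (k : ℕ) : H (k + 1) = H k + 1 / ((k : ℚ) + 1) := by
  rw [H, Finset.sum_Icc_succ_top (by omega), H]
  push_cast
  rfl

theorem sum_choose_div_succ (m : ℕ) :
    ∑ k ∈ Finset.range (m + 1), (Nat.choose m k : ℚ) * (1 / ((k : ℚ) + 1)) =
      (2 ^ (m + 1) - 1) / ((m : ℚ) + 1) := by
  have hm : (m : ℚ) + 1 ≠ 0 := by positivity
  have hsum : ∑ k ∈ Finset.range (m + 1), (Nat.choose (m + 1) (k + 1) : ℚ) =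
      2 ^ (m + 1) - 1 := by
    have h : (∑ k ∈ Finset.range (m + 2), (Nat.choose (m + 1) k : ℚ)) = 2 ^ (m + 1) := by
      exact_mod_cast Nat.sum_range_choose (m + 1)
    rw [Finset.sum_range_succ'] at h
    simp only [Nat.choose_zero_right, Nat.cast_one] at h
    linarith
  rw [← hsum, Finset.sum_div]
  refine Finset.sum_congr rfl fun k _ => ?_
  have hk : (k : ℚ) + 1 ≠ 0 := by positivity
  have h : ((m : ℚ) + 1) * Nat.choose m k = Nat.choose (m + 1) (k + 1) * ((k : ℚ) + 1) := by
    exact_mod_cast Nat.add_one_mul_choose_eq m k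
  rw [mul_one_div, div_eq_div_iff hk hm, ← h, mul_comm]

theorem sum_choose_succ_mul_H (m : ℕ) :
    ∑ k ∈ Finset.range (m + 1), (Nat.choose m (k + 1) : ℚ) * H (k + 1) = S m := by
  rw [S, Finset.sum_range_succ, Finset.sum_range_succ']
  simp [H_zero]

/-- The first-order recurrence `S(m+1) − 2·S(m) = (2^{m+1} − 1)/(m + 1)`. -/
theorem S_recurrence (m : ℕ) :
    S (m + 1) - 2 * S m = (2 ^ (m + 1) - 1) / ((m : ℚ) + 1) := by
  have h : S (m + 1) = S m +
      ∑ k ∈ Finset.range (m + 1), (Nat.choose m k : ℚ) * (1 / ((k : ℚ) + 1)) +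
      ∑ k ∈ Finset.range (m + 1), (Nat.choose m (k + 1) : ℚ) * H (k + 1) := by
    rw [S, S, Finset.sum_range_succ', H_zero, mul_zero, add_zero,
      ← Finset.sum_add_distrib, ← Finset.sum_add_distrib]
    refine Finset.sum_congr rfl fun k _ => ?_
    rw [Nat.choose_succ_succ, H_succ]
    push_cast
    ring
  rw [h, sum_choose_div_succ, sum_choose_succ_mul_H]
  ring

end PaperStmt18
end
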